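/- Let S¹ be the unit circle with intrinsic metric and I_λ = [0,λ] ⊆ ℝ. For every λ with 5π/3 ≤ λ ≤ 2π, the Gromov–Hausdorff distance equals d_GH(I_λ, S¹) = (λ − π)/2. -/

import Mathlib

open Set Metric Real
open scoped ENNReal

/-- A correspondence between `X` and `Y`: a subset of `X × Y` whose projections
to both factors are surjective. -/
def IsCorrespondence (X Y : Type*) (R : Set (X × Y)) : Prop :=
  (∀ x : X, ∃ y : Y, (x, y) ∈ R) ∧ ∀ y : Y, ∃ x : X, (x, y) ∈ R

/-- The distortion of a relation `R ⊆ X × Y`: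
`sup { ||x₁x₂| − |y₁y₂|| : (x₁,y₁), (x₂,y₂) ∈ R }`. -/
noncomputable def corDistortion (X Y : Type*) [MetricSpace X] [MetricSpace Y]
    (R : Set (X × Y)) : ℝ≥0∞ :=
  ⨆ p ∈ R, ⨆ q ∈ R, ENNReal.ofReal |dist p.1 q.1 - dist p.2 q.2|

/-- The Gromov–Hausdorff distance between metric spaces `X` and `Y`:
half the infimum of distortions of correspondences between `X` and `Y`. -/
noncomputable def ghDist (X Y : Type*) [MetricSpace X] [MetricSpace Y] : ℝ≥0∞ :=
  (⨅ R ∈ {R : Set (X × Y) | IsCorrespondence X Y R}, corDistortion X Y R) / 2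

/-- `X` is `(b,n)`-homogeneous: every point of `X` belongs to some `b`-separated
`n`-point subset of `X`. -/
def IsHomogeneous (X : Type*) [MetricSpace X] (b : ℝ) (n : ℕ) : Prop :=
  ∀ x : X, ∃ S : Finset X, x ∈ S ∧ S.card = n ∧
    ∀ p ∈ S, ∀ q ∈ S, p ≠ q → b ≤ dist p q

/-- `X` is round: it is `(b,2)`-homogeneous for every `0 < b < diam X`. -/
def IsRound (X : Type*) [MetricSpace X] : Prop :=
  ∀ b : ℝ, 0 < b → ENNReal.ofReal b < EMetric.diam (univ : Set X) →
    IsHomogeneous X b 2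

/-- The nonlinearity degree of a metric space `X`:
`inf_{f ∈ Lip₁(X)} sup { |xy| − |f(x) − f(y)| : x, y ∈ X }`. -/
noncomputable def nonlinDeg (X : Type*) [MetricSpace X] : ℝ≥0∞ :=
  ⨅ f ∈ {f : X → ℝ | LipschitzWith 1 f},
    ⨆ x : X, ⨆ y : X, ENNReal.ofReal (dist x y - |f x - f y|)

lemma circ_dist (a b : ℝ) (h : |a - b| ≤ 2 * π) :
    dist (a : AddCircle (2 * π)) (b : AddCircle (2 * π)) = min |a - b| (2 * π - |a - b|) := by
  have key : ∀ t : ℝ, 0 ≤ t → t ≤ 2 * π →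
      ‖(t : AddCircle (2 * π))‖ = min t (2 * π - t) := by
    intro t ht0 ht
    have hp := Real.pi_pos
    have hp2 : |2 * π| = 2 * π := abs_of_pos (by linarith)
    rcases le_total t π with h | h
    · rw [(AddCircle.norm_coe_eq_abs_iff (p := 2 * π) (by positivity)).2
        (by rw [hp2, abs_of_nonneg ht0]; linarith), abs_of_nonneg ht0, min_eq_left (by linarith)]
    · have e : (t : AddCircle (2 * π)) = ((t - 2 * π : ℝ) : AddCircle (2 * π)) := by
        rw [AddCircle.coe_sub, AddCircle.coe_period, sub_zero]
      rw [e, (AddCircle.norm_coe_eq_abs_iff (p := 2 * π) (by positivity)).2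
        (by rw [hp2, abs_of_nonpos (by linarith)]; linarith), abs_of_nonpos (by linarith),
        min_eq_right (by linarith)]
      ring
  rw [dist_eq_norm, ← AddCircle.coe_sub, ← key _ (abs_nonneg _) h]
  rcases abs_choice (a - b) with e | e
  · rw [e]
  · rw [e, AddCircle.coe_neg, norm_neg]

lemma circ_dist_cases (a b : ℝ) (h : |a - b| ≤ 2 * π) :
    ∃ δ, dist (a : AddCircle (2 * π)) (b : AddCircle (2 * π)) = δ ∧ δ ≤ |a - b| ∧
      δ ≤ 2 * π - |a - b| ∧ (δ = |a - b| ∨ δ = 2 * π - |a - b|) :=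
  ⟨_, circ_dist a b h, min_le_left _ _, min_le_right _ _, min_choice _ _⟩

lemma circ_dist_le (y z : AddCircle (2 * π)) : dist y z ≤ π := by
  have := AddCircle.norm_le_half_period (2 * π) (x := y - z) (by positivity)
  rw [dist_eq_norm]
  rw [abs_of_pos (by positivity)] at this
  linarith

def graphRel (d x t : ℝ) : Prop :=
  (0 ≤ t ∧ t ≤ π / 2 ∧ x = t) ∨ (π / 2 ≤ t ∧ t ≤ π ∧ x = t + d) ∨
    (-π ≤ t ∧ t ≤ 0 ∧ x = -t + d / 2)

lemma graphRel_dist {d x₁ t₁ x₂ t₂ : ℝ} (hd : 2 * π / 3 ≤ d)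
    (h₁ : graphRel d x₁ t₁) (h₂ : graphRel d x₂ t₂) :
    |(|x₁ - x₂|) - dist (t₁ : AddCircle (2 * π)) (t₂ : AddCircle (2 * π))| ≤ d := by
  have hp := Real.pi_pos
  have hb : ∀ {x t}, graphRel d x t → -π ≤ t ∧ t ≤ π := by
    rintro x t (⟨_, _, _⟩ | ⟨_, _, _⟩ | ⟨_, _, _⟩) <;> constructor <;> linarith
  have b₁ := hb h₁
  have b₂ := hb h₂
  obtain ⟨δ, e, l1, l2, l3⟩ := circ_dist_cases t₁ t₂ (abs_le.2 ⟨by linarith, by linarith⟩)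
  rw [e]
  rw [abs_le]
  rcases h₁ with ⟨_, _, rfl⟩ | ⟨_, _, rfl⟩ | ⟨_, _, rfl⟩ <;>
  rcases h₂ with ⟨_, _, rfl⟩ | ⟨_, _, rfl⟩ | ⟨_, _, rfl⟩ <;>
  grind

theorem ghDist_segment_circle_large {lam : ℝ} (h1 : 5 * π / 3 ≤ lam)
    (h2 : lam ≤ 2 * π) :
    ghDist ↥(Set.Icc (0:ℝ) lam) (AddCircle (2 * π)) = ENNReal.ofReal ((lam - π) / 2) := by
  have hp := Real.pi_pos
  unfold ghDist
  rw [ENNReal.ofReal_div_of_pos (by norm_num : (0:ℝ) < 2), ENNReal.ofReal_ofNat]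
  congr 1
  apply le_antisymm
  · refine iInf₂_le_of_le {p | ∃ t : ℝ, p.2 = (t : AddCircle (2 * π)) ∧
      graphRel (lam - π) p.1 t} ⟨?_, ?_⟩ ?_
    · rintro ⟨x, hx0, hx⟩
      rcases le_total x (π / 2) with h | h
      · exact ⟨(x : ℝ), x, rfl, Or.inl ⟨hx0, h, rfl⟩⟩
      rcases le_total x (π / 2 + (lam - π)) with h' | h'
      · exact ⟨((-(x - (lam - π) / 2) : ℝ) : AddCircle (2 * π)), _, rfl,
          Or.inr (Or.inr ⟨by linarith, by linarith, by ring⟩)⟩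
      · exact ⟨((x - (lam - π) : ℝ) : AddCircle (2 * π)), _, rfl,
          Or.inr (Or.inl ⟨by linarith, by linarith, by ring⟩)⟩
    · intro y
      haveI : Fact (0 < 2 * π) := ⟨by positivity⟩
      obtain ⟨t, ⟨ht1, ht2⟩, rfl⟩ : ∃ t ∈ Set.Ico (-π) (-π + 2 * π), (t : AddCircle (2 * π)) = y := by
        have := AddCircle.coe_image_Ico_eq (2 * π) (-π)
        have hy : y ∈ (Set.univ : Set (AddCircle (2 * π))) := trivial
        rw [← this] at hy
        exact hy
      rcases le_total t 0 with h | h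
      · exact ⟨⟨-t + (lam - π) / 2, by linarith, by linarith⟩, t, rfl,
          Or.inr (Or.inr ⟨ht1, h, rfl⟩)⟩
      rcases le_total t (π / 2) with h' | h'
      · exact ⟨⟨t, h, by linarith⟩, t, rfl, Or.inl ⟨h, h', rfl⟩⟩
      · exact ⟨⟨t + (lam - π), by linarith, by linarith⟩, t, rfl,
          Or.inr (Or.inl ⟨h', by linarith, rfl⟩)⟩
    · refine iSup₂_le fun p hp' => iSup₂_le fun q hq => ?_
      obtain ⟨t, ht, hr⟩ := hp'
      obtain ⟨s, hs, hr'⟩ := hq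
      apply ENNReal.ofReal_le_ofReal
      rw [ht, hs, Subtype.dist_eq, Real.dist_eq]
      exact graphRel_dist (by linarith) hr hr'
  · refine le_iInf₂ fun R hR => ?_
    obtain ⟨y, hy⟩ := hR.1 ⟨0, le_refl _, by linarith⟩
    obtain ⟨z, hz⟩ := hR.1 ⟨lam, by linarith, le_refl _⟩
    refine le_trans ?_ (le_iSup₂_of_le _ hz (le_iSup₂_of_le _ hy le_rfl))
    apply ENNReal.ofReal_le_ofReal
    rw [Subtype.dist_eq, Real.dist_eq]
    have := circ_dist_le z y
    refine le_trans ?_ (le_abs_self _)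
    simp only [sub_zero]
    have := le_abs_self lam
    linarith
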